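/- Under Assumptions (A1)–(A6) and additionally (A7): ∫_{ℝ^d} ‖θ‖ π(θ) dθ < ∞ (the prior has a finite first moment), the random variables ∫_{√N(Θ−T_N)} (1+‖t‖)·|π_N(t|·) − φ_{0,(V*)⁻¹}(t)| dt converge to 0 in P-probability as N → ∞, where φ_{0,(V*)⁻¹} is the density of the d-variate normal distribution with mean 0 and covariance matrix (V*)⁻¹. (Misspecified Bernstein–von Mises theorem, first-moment-weighted form.) -/

import Mathlib

open MeasureTheory Filter Matrix

attribute [local instance] Matrix.frobeniusNormedAddCommGroup

/-- A real positive definite matrix factors as `Bᵀ * B` with `B` invertible. -/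
theorem Matrix.PosDef.exists_transpose_mul_self {d : ℕ} {A : Matrix (Fin d) (Fin d) ℝ}
    (hA : A.PosDef) : ∃ B : Matrix (Fin d) (Fin d) ℝ, A = Bᵀ * B ∧ B.det ≠ 0 := by
  open scoped MatrixOrder in
  obtain ⟨B, hB⟩ := CStarAlgebra.nonneg_iff_eq_star_mul_self.mp hA.posSemidef.nonneg
  have hB' : A = Bᵀ * B := by
    rw [hB, star_eq_conjTranspose, conjTranspose_eq_transpose_of_trivial]
  refine ⟨B, hB', fun h => ?_⟩
  have := hA.det_pos
  rw [hB', det_mul, h, mul_zero] at this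
  exact lt_irrefl _ this

theorem dotProduct_transpose_mul_self_mulVec {d : ℕ} (B : Matrix (Fin d) (Fin d) ℝ)
    (x : Fin d → ℝ) : x ⬝ᵥ (Bᵀ * B).mulVec x = ∑ i, (B.mulVec x i) ^ 2 := by
  rw [← mulVec_mulVec, dotProduct_mulVec, vecMul_transpose]
  simp [dotProduct, sq]

theorem abs_dotProduct_le_card_mul {d : ℕ} (x y : Fin d → ℝ) :
    |x ⬝ᵥ y| ≤ d * (‖x‖ * ‖y‖) := by
  refine (Finset.abs_sum_le_sum_abs _ _).trans ?_
  calc ∑ i, |x i * y i| ≤ ∑ _i : Fin d, ‖x‖ * ‖y‖ := by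
        refine Finset.sum_le_sum fun i _ => ?_
        rw [abs_mul]
        exact mul_le_mul (norm_le_pi_norm x i) (norm_le_pi_norm y i) (abs_nonneg _) (norm_nonneg _)
    _ = d * (‖x‖ * ‖y‖) := by simp

theorem abs_apply_le_frobenius_norm {d : ℕ} (A : Matrix (Fin d) (Fin d) ℝ) (i j : Fin d) :
    |A i j| ≤ ‖A‖ := by
  rw [frobenius_norm_def, ← Real.sqrt_eq_rpow]
  refine Real.abs_le_sqrt ?_
  calc A i j ^ 2 ≤ ∑ j, ‖A i j‖ ^ (2 : ℝ) := by
        have := Finset.single_le_sum (f := fun j => ‖A i j‖ ^ (2 : ℝ))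
          (fun j _ => by positivity) (Finset.mem_univ j)
        simpa using this
    _ ≤ ∑ i, ∑ j, ‖A i j‖ ^ (2 : ℝ) :=
        Finset.single_le_sum (f := fun i => ∑ j, ‖A i j‖ ^ (2 : ℝ))
          (fun i _ => by positivity) (Finset.mem_univ i)

theorem norm_mulVec_le_card_mul {d : ℕ} (A : Matrix (Fin d) (Fin d) ℝ) (x : Fin d → ℝ) :
    ‖A.mulVec x‖ ≤ d * (‖A‖ * ‖x‖) := by
  refine (pi_norm_le_iff_of_nonneg (by positivity)).2 fun i => ?_
  refine (abs_dotProduct_le_card_mul _ _).trans ?_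
  gcongr
  exact (pi_norm_le_iff_of_nonneg (norm_nonneg _)).2 fun j => abs_apply_le_frobenius_norm A i j

theorem abs_quadratic_le {d : ℕ} (A : Matrix (Fin d) (Fin d) ℝ) (x : Fin d → ℝ) :
    |x ⬝ᵥ A.mulVec x| ≤ (d : ℝ) ^ 2 * ‖A‖ * ‖x‖ ^ 2 := by
  refine (abs_dotProduct_le_card_mul _ _).trans ?_
  calc (d : ℝ) * (‖x‖ * ‖A.mulVec x‖) ≤ d * (‖x‖ * (d * (‖A‖ * ‖x‖))) := by
        gcongr; exact norm_mulVec_le_card_mul A x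
    _ = _ := by ring

theorem Matrix.PosDef.exists_pos_mul_norm_sq_le {d : ℕ} {A : Matrix (Fin d) (Fin d) ℝ}
    (hA : A.PosDef) : ∃ c : ℝ, 0 < c ∧ ∀ x : Fin d → ℝ, c * ‖x‖ ^ 2 ≤ x ⬝ᵥ A.mulVec x := by
  obtain ⟨B, rfl, hB⟩ := hA.exists_transpose_mul_self
  set K : ℝ := d * ‖B⁻¹‖ + 1
  have hK : 0 < K := by positivity
  refine ⟨(K ^ 2)⁻¹, by positivity, fun x => ?_⟩
  rw [dotProduct_transpose_mul_self_mulVec]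
  have hx : ‖x‖ ≤ K * ‖B.mulVec x‖ := by
    have h1 : x = B⁻¹.mulVec (B.mulVec x) := by
      rw [mulVec_mulVec, nonsing_inv_mul _ (isUnit_iff_ne_zero.2 hB), one_mulVec]
    calc ‖x‖ = ‖B⁻¹.mulVec (B.mulVec x)‖ := by rw [← h1]
      _ ≤ d * (‖B⁻¹‖ * ‖B.mulVec x‖) := norm_mulVec_le_card_mul _ _
      _ ≤ K * ‖B.mulVec x‖ := by simp only [K]; nlinarith [norm_nonneg (B.mulVec x)]
  have hsq : ‖B.mulVec x‖ ≤ √(∑ i, (B.mulVec x i) ^ 2) := by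
    refine (pi_norm_le_iff_of_nonneg (Real.sqrt_nonneg _)).2 fun i => ?_
    exact Real.abs_le_sqrt (Finset.single_le_sum (f := fun i => (B.mulVec x i) ^ 2)
      (fun i _ => sq_nonneg _) (Finset.mem_univ i))
  have h0 : 0 ≤ ∑ i, (B.mulVec x i) ^ 2 := Finset.sum_nonneg fun i _ => sq_nonneg _
  rw [inv_mul_le_iff₀ (by positivity)]
  calc ‖x‖ ^ 2 ≤ (K * √(∑ i, (B.mulVec x i) ^ 2)) ^ 2 := by
        gcongr; exact hx.trans (by gcongr)
    _ = _ := by rw [mul_pow, Real.sq_sqrt h0]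

theorem integral_exp_neg_half_quadratic {d : ℕ} {A : Matrix (Fin d) (Fin d) ℝ} (hA : A.PosDef) :
    ∫ x : Fin d → ℝ, Real.exp (-(1 / 2) * (x ⬝ᵥ A.mulVec x)) =
      ((2 * Real.pi) ^ (-(d : ℝ) / 2) * A.det ^ ((1 : ℝ) / 2))⁻¹ := by
  obtain ⟨B, rfl, hB⟩ := hA.exists_transpose_mul_self
  have hmap := Real.map_matrix_volume_pi_eq_smul_volume_pi hB
  have hmeas : Measurable (toLin' B) := (toLin' B).continuous_of_finiteDimensional.measurable
  set f : (Fin d → ℝ) → ℝ := fun y => ∏ i, Real.exp (-(1 / 2) * y i ^ 2)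
  have hf : Continuous f := by fun_prop
  have h1 : ∀ x : Fin d → ℝ, Real.exp (-(1 / 2) * (x ⬝ᵥ (Bᵀ * B).mulVec x)) = f (toLin' B x) := by
    intro x
    rw [dotProduct_transpose_mul_self_mulVec, Finset.mul_sum, Real.exp_sum]
    simp [f, toLin'_apply]
  have h2 : ∫ y, f y = (2 * Real.pi) ^ ((d : ℝ) / 2) := by
    rw [integral_fintype_prod_volume_eq_pow (fun y : ℝ => Real.exp (-(1 / 2) * y ^ 2)),
      integral_gaussian, Fintype.card_fin, Real.sqrt_eq_rpow, ← Real.rpow_natCast,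
      ← Real.rpow_mul (by positivity)]
    congr 1 <;> ring
  simp_rw [h1]
  rw [← integral_map hmeas.aemeasurable hf.aestronglyMeasurable, hmap, integral_smul_measure, h2,
    ENNReal.toReal_ofReal (abs_nonneg _), det_mul, det_transpose, ← Real.sqrt_eq_rpow,
    Real.sqrt_mul_self_eq_abs, mul_inv, ← Real.rpow_neg (by positivity), abs_inv, smul_eq_mul,
    mul_comm]
  congr 2
  ring

theorem integrable_exp_neg_mul_pi_norm_sq {d : ℕ} {c : ℝ} (hc : 0 < c) :
    Integrable fun x : Fin d → ℝ => Real.exp (-c * ‖x‖ ^ 2) := by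
  rcases Nat.eq_zero_or_pos d with rfl | hd
  · have : (fun x : Fin 0 → ℝ => Real.exp (-c * ‖x‖ ^ 2)) = fun _ => 1 := by
      ext x; simp [Subsingleton.elim x 0]
    rw [this]
    have : IsFiniteMeasure (volume : Measure (Fin 0 → ℝ)) := by
      rw [volume_pi]; infer_instance
    exact integrable_const _
  have hd' : (0 : ℝ) < d := by exact_mod_cast hd
  have h : Integrable fun x : Fin d → ℝ => ∏ i, Real.exp (-(c / d) * x i ^ 2) :=
    Integrable.fintype_prod (μ := fun _ => volume)
      (f := fun _ y => Real.exp (-(c / d) * y ^ 2)) fun _ =>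
        integrable_exp_neg_mul_sq (by positivity)
  refine h.mono' (by fun_prop) (ae_of_all _ fun x => ?_)
  rw [Real.norm_eq_abs, Real.abs_exp, ← Real.exp_sum, Real.exp_le_exp, ← Finset.mul_sum,
    neg_mul, neg_mul, neg_le_neg_iff]
  have : ∑ i, x i ^ 2 ≤ d * ‖x‖ ^ 2 := by
    calc ∑ i, x i ^ 2 ≤ ∑ _i : Fin d, ‖x‖ ^ 2 :=
          Finset.sum_le_sum fun i _ => by
            rw [← sq_abs]; gcongr; exact norm_le_pi_norm x i
      _ = d * ‖x‖ ^ 2 := by simp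
  calc c / d * ∑ i, x i ^ 2 ≤ c / d * (d * ‖x‖ ^ 2) := by gcongr
    _ = c * ‖x‖ ^ 2 := by field_simp

theorem integrable_one_add_norm_mul_exp_neg_mul_pi_norm_sq {d : ℕ} {c : ℝ} (hc : 0 < c) :
    Integrable fun x : Fin d → ℝ => (1 + ‖x‖) * Real.exp (-c * ‖x‖ ^ 2) := by
  refine ((integrable_exp_neg_mul_pi_norm_sq (d := d) (half_pos hc)).const_mul
    (Real.exp (1 / (2 * c)))).mono' (by fun_prop) (ae_of_all _ fun x => ?_)
  rw [Real.norm_of_nonneg (by positivity), ← Real.exp_add]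
  calc (1 + ‖x‖) * Real.exp (-c * ‖x‖ ^ 2) ≤ Real.exp ‖x‖ * Real.exp (-c * ‖x‖ ^ 2) := by
        gcongr; linarith [Real.add_one_le_exp ‖x‖]
    _ = Real.exp (‖x‖ + -c * ‖x‖ ^ 2) := (Real.exp_add _ _).symm
    _ ≤ _ := by
        rw [Real.exp_le_exp]
        have : 1 / (2 * c) + -(c / 2) * ‖x‖ ^ 2 - (‖x‖ + -c * ‖x‖ ^ 2) =
            (c * ‖x‖ - 1) ^ 2 / (2 * c) := by field_simp; ring
        have h2 : 0 ≤ (c * ‖x‖ - 1) ^ 2 / (2 * c) := by positivity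
        linarith

theorem integral_comp_add_inv_smul {d : ℕ} (f : (Fin d → ℝ) → ℝ) (T : Fin d → ℝ) {s : ℝ}
    (hs : 0 < s) : ∫ t, f (T + s⁻¹ • t) = s ^ d * ∫ x, f x := by
  have h := Measure.integral_comp_inv_smul_of_nonneg (volume : Measure (Fin d → ℝ))
    (fun x => f (T + x)) hs.le
  rw [h, integral_add_left_eq_self]
  simp

theorem MeasureTheory.Integrable.comp_add_inv_smul {d : ℕ} {f : (Fin d → ℝ) → ℝ} (hf : Integrable f)
    (T : Fin d → ℝ) {s : ℝ} (hs : 0 < s) : Integrable fun t => f (T + s⁻¹ • t) :=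
  (hf.comp_add_left T).comp_smul (inv_ne_zero hs.ne')

theorem integral_one_add_norm_mul_comp_le {d : ℕ} {π : (Fin d → ℝ) → ℝ} (hπnn : ∀ θ, 0 ≤ π θ)
    (hπint : Integrable π) (hπmom : Integrable fun θ => ‖θ‖ * π θ) {τ : ℝ}
    {T : Fin d → ℝ} (hT : ‖T‖ ≤ τ) {s : ℝ} (hs : 1 ≤ s) :
    Integrable (fun t => (1 + ‖t‖) * π (T + s⁻¹ • t)) ∧
    ∫ t, (1 + ‖t‖) * π (T + s⁻¹ • t) ≤
      s ^ (d + 1) * ((1 + τ) * (∫ θ, π θ) + ∫ θ, ‖θ‖ * π θ) := by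
  have hs0 : 0 < s := by linarith
  have hint : Integrable fun θ => s * ((1 + τ) * π θ + ‖θ‖ * π θ) :=
    ((hπint.const_mul _).add hπmom).const_mul _
  have hle : ∀ t : Fin d → ℝ, (1 + ‖t‖) * π (T + s⁻¹ • t) ≤
      s * ((1 + τ) * π (T + s⁻¹ • t) + ‖T + s⁻¹ • t‖ * π (T + s⁻¹ • t)) := by
    intro t
    have h1 : ‖t‖ ≤ s * (τ + ‖T + s⁻¹ • t‖) := by
      calc ‖t‖ = s * ‖s⁻¹ • t‖ := by
            rw [norm_smul, Real.norm_of_nonneg (by positivity)]; field_simp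
        _ = s * ‖(T + s⁻¹ • t) - T‖ := by congr 2; abel
        _ ≤ s * (τ + ‖T + s⁻¹ • t‖) := by
            gcongr; linarith [norm_sub_le (T + s⁻¹ • t) T]
    rw [← add_mul, ← mul_assoc]
    exact mul_le_mul_of_nonneg_right (by linarith) (hπnn _)
  have hint' := Integrable.comp_add_inv_smul hint T hs0
  have hmeas : AEStronglyMeasurable (fun t => (1 + ‖t‖) * π (T + s⁻¹ • t)) :=
    (by fun_prop : AEStronglyMeasurable fun t : Fin d → ℝ => 1 + ‖t‖).mul
      (Integrable.comp_add_inv_smul hπint T hs0).aestronglyMeasurable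
  have hnn : ∀ t : Fin d → ℝ, 0 ≤ (1 + ‖t‖) * π (T + s⁻¹ • t) := fun t =>
    mul_nonneg (by positivity) (hπnn _)
  refine ⟨hint'.mono' hmeas (ae_of_all _ fun t => ?_), ?_⟩
  · rw [Real.norm_of_nonneg (hnn t)]; exact hle t
  · refine (integral_mono_of_nonneg (ae_of_all _ hnn) hint' (ae_of_all _ hle)).trans ?_
    rw [integral_comp_add_inv_smul (fun θ => s * ((1 + τ) * π θ + ‖θ‖ * π θ)) T hs0,
      integral_const_mul,
      integral_add (hπint.const_mul _) hπmom, integral_const_mul]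
    exact le_of_eq (by ring)

theorem tendsto_pow_mul_exp_neg_mul_sq_atTop (m : ℕ) {ε : ℝ} (hε : 0 < ε) :
    Tendsto (fun x : ℝ => x ^ m * Real.exp (-(ε * x ^ 2))) atTop (nhds 0) := by
  have h := ((Real.tendsto_pow_mul_exp_neg_atTop_nhds_zero m).comp
    (tendsto_id.const_mul_atTop hε)).const_mul (ε ^ m)⁻¹
  rw [mul_zero] at h
  refine squeeze_zero' ?_ ?_ h
  · filter_upwards [eventually_ge_atTop 0] with x hx using by positivity
  · filter_upwards [eventually_ge_atTop 1] with x hx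
    have : (ε ^ m)⁻¹ * ((fun x => x ^ m * Real.exp (-x)) ∘ fun x => ε * id x) x =
        x ^ m * Real.exp (-(ε * x)) := by
      simp only [Function.comp, id, mul_pow]; field_simp
    rw [this]
    gcongr
    nlinarith

theorem measurable_indicator_mul_exp {d : ℕ} {Θ : Set (Fin d → ℝ)} (hΘ : MeasurableSet Θ)
    {π w : (Fin d → ℝ) → ℝ} (hπ : Measurable π) (hw : ContinuousOn w Θ) :
    Measurable (Θ.indicator fun θ => π θ * Real.exp (w θ)) := by
  classical
  have h : Measurable (Θ.piecewise (fun θ => Real.exp (w θ)) 0) :=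
    (Real.continuous_exp.comp_continuousOn hw).measurable_piecewise continuousOn_const hΘ
  convert hπ.mul h using 1
  ext θ
  by_cases hθ : θ ∈ Θ <;> simp [hθ]

/-- Weighted `L¹` convergence of a sequence of rescaled unnormalised posteriors. -/
theorem tendsto_integral_one_add_norm_mul_abs_sub {d : ℕ} {Θ : Set (Fin d → ℝ)}
    (hΘ : MeasurableSet Θ) {π : (Fin d → ℝ) → ℝ} (hπnn : ∀ θ, 0 ≤ π θ) (hπmeas : Measurable π)
    (hπint : Integrable π) (hπmom : Integrable fun θ => ‖θ‖ * π θ)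
    {θ₀ : Fin d → ℝ} (hθ₀ : θ₀ ∈ interior Θ) (hπcont : ContinuousAt π θ₀)
    {T : ℕ → Fin d → ℝ} (hT : Tendsto T atTop (nhds θ₀))
    {s : ℕ → ℝ} (hs : Tendsto s atTop atTop)
    {w : ℕ → (Fin d → ℝ) → ℝ} (hw : ∀ k, ContinuousOn (w k) Θ)
    {φ : (Fin d → ℝ) → ℝ} (hφ : Continuous φ)
    (hlim : ∀ t, Tendsto (fun k => w k (T k + (s k)⁻¹ • t)) atTop (nhds (φ t)))
    {c K : ℝ} (hc : 0 < c) (hφle : ∀ t, φ t ≤ K - c * ‖t‖ ^ 2)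
    (hloc : ∃ δ : ℝ, 0 < δ ∧ ∀ᶠ k in atTop, ∀ θ ∈ Θ, ‖θ - T k‖ ≤ δ →
      w k θ ≤ K - c * (s k * ‖θ - T k‖) ^ 2)
    (hfar : ∀ δ : ℝ, 0 < δ → ∃ ε : ℝ, 0 < ε ∧ ∀ᶠ k in atTop, ∀ θ ∈ Θ, δ ≤ ‖θ - T k‖ →
      w k θ ≤ -(ε * s k ^ 2)) :
    (∀ᶠ k in atTop, Integrable fun t => (1 + ‖t‖) *
      |Θ.indicator (fun θ => π θ * Real.exp (w k θ)) (T k + (s k)⁻¹ • t) -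
        π θ₀ * Real.exp (φ t)|) ∧
    Tendsto (fun k => ∫ t, (1 + ‖t‖) *
      |Θ.indicator (fun θ => π θ * Real.exp (w k θ)) (T k + (s k)⁻¹ • t) -
        π θ₀ * Real.exp (φ t)|) atTop (nhds 0) := by
  obtain ⟨δ₁, hδ₁, hloc⟩ := hloc
  obtain ⟨ρ, hρ, hρπ⟩ : ∃ ρ > 0, ∀ θ, ‖θ - θ₀‖ < ρ → π θ ≤ π θ₀ + 1 := by
    have := hπcont.eventually (gt_mem_nhds (lt_add_one (π θ₀)))
    obtain ⟨ρ, hρ, h⟩ := Metric.eventually_nhds_iff.1 this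
    exact ⟨ρ, hρ, fun θ hθ => (h (by rwa [dist_eq_norm])).le⟩
  set δ := min δ₁ (ρ / 2)
  have hδ : 0 < δ := by positivity
  obtain ⟨ε, hε, hfar⟩ := hfar δ hδ
  set F : ℕ → (Fin d → ℝ) → ℝ := fun k t =>
    Θ.indicator (fun θ => π θ * Real.exp (w k θ)) (T k + (s k)⁻¹ • t)
  set S : ℕ → Set (Fin d → ℝ) := fun k => {t | ‖(s k)⁻¹ • t‖ ≤ δ}
  have hSmeas : ∀ k, MeasurableSet (S k) := fun k => measurableSet_le (by fun_prop) (by fun_prop)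
  have hFmeas : ∀ k, Measurable (F k) := fun k =>
    (measurable_indicator_mul_exp hΘ hπmeas (hw k)).comp (by fun_prop)
  have hFnn : ∀ k t, 0 ≤ F k t := fun k t =>
    Set.indicator_nonneg (fun θ _ => mul_nonneg (hπnn θ) (Real.exp_pos _).le) _
  have hs0 : ∀ᶠ k in atTop, 1 ≤ s k := hs.eventually_ge_atTop 1
  have hTρ : ∀ᶠ k in atTop, ‖T k - θ₀‖ < ρ / 2 := by
    simpa [dist_eq_norm] using Metric.tendsto_nhds.1 hT (ρ / 2) (by positivity)
  have hTτ : ∀ᶠ k in atTop, ‖T k‖ ≤ ‖θ₀‖ + 1 :=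
    hT.norm.eventually (ge_mem_nhds (lt_add_one _))
  have hsinv : Tendsto (fun k => (s k)⁻¹) atTop (nhds 0) := tendsto_inv_atTop_zero.comp hs
  have hpt : ∀ t, Tendsto (fun k => T k + (s k)⁻¹ • t) atTop (nhds θ₀) := fun t => by
    simpa using hT.add (hsinv.smul_const t)
  have hFlim : ∀ t, Tendsto (fun k => F k t) atTop (nhds (π θ₀ * Real.exp (φ t))) := by
    intro t
    refine ((hπcont.tendsto.comp (hpt t)).mul
      ((Real.continuous_exp.tendsto _).comp (hlim t))).congr' ?_
    filter_upwards [(hpt t).eventually (mem_interior_iff_mem_nhds.1 hθ₀)] with k hk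
    simp [F, Set.indicator_of_mem (show T k + (s k)⁻¹ • t ∈ Θ from hk)]
  have hSlim : ∀ t, ∀ᶠ k in atTop, t ∈ S k := by
    intro t
    have : Tendsto (fun k => ‖(s k)⁻¹ • t‖) atTop (nhds 0) := by
      simpa using (hsinv.smul_const t).norm
    exact this.eventually (ge_mem_nhds hδ)
  set g : (Fin d → ℝ) → ℝ := fun t => π θ₀ * Real.exp (φ t)
  have hgmeas : Measurable g := by fun_prop
  set D : (Fin d → ℝ) → ℝ := fun t =>
    (2 * π θ₀ + 1) * Real.exp K * ((1 + ‖t‖) * Real.exp (-c * ‖t‖ ^ 2))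
  have hDint : Integrable D := (integrable_one_add_norm_mul_exp_neg_mul_pi_norm_sq hc).const_mul _
  have hnear : ∀ᶠ k in atTop, ∀ t,
      (1 + ‖t‖) * |(S k).indicator (F k) t - g t| ≤ D t := by
    filter_upwards [hloc, hs0, hTρ] with k hk hsk hTk t
    have hsk0 : 0 < s k := by linarith
    have hE : Real.exp (K - c * ‖t‖ ^ 2) = Real.exp K * Real.exp (-c * ‖t‖ ^ 2) := by
      rw [← Real.exp_add]; ring_nf
    have hgt : g t ≤ π θ₀ * Real.exp (K - c * ‖t‖ ^ 2) :=
      mul_le_mul_of_nonneg_left (Real.exp_le_exp.2 (hφle t)) (hπnn _)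
    have hg0 : 0 ≤ g t := mul_nonneg (hπnn _) (Real.exp_pos _).le
    have hA0 : 0 ≤ (S k).indicator (F k) t := Set.indicator_nonneg (fun t _ => hFnn k t) _
    have hA : (S k).indicator (F k) t ≤ (π θ₀ + 1) * Real.exp (K - c * ‖t‖ ^ 2) := by
      have hR : 0 ≤ (π θ₀ + 1) * Real.exp (K - c * ‖t‖ ^ 2) :=
        mul_nonneg (by linarith [hπnn θ₀]) (Real.exp_pos _).le
      refine Set.indicator_apply_le' (fun ht => ?_) fun _ => hR
      refine Set.indicator_apply_le' (fun hθ => ?_) fun _ => hR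
      have ht' : ‖(s k)⁻¹ • t‖ ≤ δ := ht
      have hd : T k + (s k)⁻¹ • t - T k = (s k)⁻¹ • t := by abel
      have hst : s k * ‖(s k)⁻¹ • t‖ = ‖t‖ := by
        rw [norm_smul, Real.norm_of_nonneg (by positivity)]; field_simp
      have h1 := hk _ hθ (by rw [hd]; exact ht'.trans (min_le_left _ _))
      rw [hd, hst] at h1
      have h2 : π (T k + (s k)⁻¹ • t) ≤ π θ₀ + 1 := by
        apply hρπ
        calc ‖T k + (s k)⁻¹ • t - θ₀‖ = ‖(T k - θ₀) + (s k)⁻¹ • t‖ := by congr 1; abel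
          _ ≤ ‖T k - θ₀‖ + ‖(s k)⁻¹ • t‖ := norm_add_le _ _
          _ < ρ := by linarith [ht'.trans (min_le_right _ _)]
      exact mul_le_mul h2 (Real.exp_le_exp.2 h1) (Real.exp_pos _).le (by linarith [hπnn θ₀])
    calc (1 + ‖t‖) * |(S k).indicator (F k) t - g t|
        ≤ (1 + ‖t‖) * ((π θ₀ + 1) * Real.exp (K - c * ‖t‖ ^ 2) +
            π θ₀ * Real.exp (K - c * ‖t‖ ^ 2)) := by
          gcongr
          rw [abs_le]
          constructor <;> linarith
      _ = D t := by rw [hE]; simp only [D]; ring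
  have hnmeas : ∀ k, AEStronglyMeasurable
      (fun t => (1 + ‖t‖) * |(S k).indicator (F k) t - g t|) := fun k => by
    have := (hFmeas k).indicator (hSmeas k)
    exact Measurable.aestronglyMeasurable (by fun_prop)
  have hnearlim : Tendsto (fun k => ∫ t, (1 + ‖t‖) * |(S k).indicator (F k) t - g t|) atTop
      (nhds 0) := by
    rw [← integral_zero (Fin d → ℝ) ℝ (μ := volume)]
    refine tendsto_integral_filter_of_dominated_convergence D (Eventually.of_forall hnmeas) ?_
      hDint (ae_of_all _ fun t => ?_)
    · filter_upwards [hnear] with k hk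
      refine ae_of_all _ fun t => ?_
      rw [Real.norm_of_nonneg (by positivity)]
      exact hk t
    · have h1 : Tendsto (fun k => (S k).indicator (F k) t) atTop (nhds (g t)) := by
        refine (hFlim t).congr' ?_
        filter_upwards [hSlim t] with k hk
        rw [Set.indicator_of_mem hk]
      simpa using ((h1.sub_const (g t)).abs).const_mul (1 + ‖t‖)
  set C := (1 + (‖θ₀‖ + 1)) * (∫ θ, π θ) + ∫ θ, ‖θ‖ * π θ
  have hfarle : ∀ᶠ k in atTop, ∀ t, (1 + ‖t‖) * (S k)ᶜ.indicator (F k) t ≤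
      Real.exp (-(ε * s k ^ 2)) * ((1 + ‖t‖) * π (T k + (s k)⁻¹ • t)) := by
    filter_upwards [hfar] with k hk t
    have hR : 0 ≤ Real.exp (-(ε * s k ^ 2)) * π (T k + (s k)⁻¹ • t) :=
      mul_nonneg (Real.exp_pos _).le (hπnn _)
    have : (S k)ᶜ.indicator (F k) t ≤ Real.exp (-(ε * s k ^ 2)) * π (T k + (s k)⁻¹ • t) := by
      refine Set.indicator_apply_le' (fun ht => ?_) fun _ => hR
      refine Set.indicator_apply_le' (fun hθ => ?_) fun _ => hR
      have ht' : δ < ‖(s k)⁻¹ • t‖ := not_le.1 ht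
      have hd : T k + (s k)⁻¹ • t - T k = (s k)⁻¹ • t := by abel
      rw [mul_comm]
      exact mul_le_mul_of_nonneg_right (Real.exp_le_exp.2 (hk _ hθ (by rw [hd]; exact ht'.le)))
        (hπnn _)
    calc _ ≤ (1 + ‖t‖) * (Real.exp (-(ε * s k ^ 2)) * π (T k + (s k)⁻¹ • t)) := by gcongr
      _ = _ := by ring
  have hfarnn : ∀ k t, 0 ≤ (1 + ‖t‖) * (S k)ᶜ.indicator (F k) t := fun k t =>
    mul_nonneg (by positivity) (Set.indicator_nonneg (fun t _ => hFnn k t) _)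
  have hfarint : ∀ᶠ k in atTop, Integrable fun t => (1 + ‖t‖) * (S k)ᶜ.indicator (F k) t := by
    filter_upwards [hfarle, hs0, hTτ] with k hk hsk hTk
    refine ((integral_one_add_norm_mul_comp_le hπnn hπint hπmom hTk hsk).1.const_mul
      (Real.exp (-(ε * s k ^ 2)))).mono' ?_ (ae_of_all _ fun t => ?_)
    · have := (hFmeas k).indicator (hSmeas k).compl
      exact Measurable.aestronglyMeasurable (by fun_prop)
    · rw [Real.norm_of_nonneg (hfarnn k t)]; exact hk t
  have hfarlim : Tendsto (fun k => ∫ t, (1 + ‖t‖) * (S k)ᶜ.indicator (F k) t) atTop (nhds 0) := by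
    have h := ((tendsto_pow_mul_exp_neg_mul_sq_atTop (d + 1) hε).comp hs).mul_const C
    rw [zero_mul] at h
    refine squeeze_zero' (Eventually.of_forall fun k => integral_nonneg (hfarnn k)) ?_ h
    filter_upwards [hfarle, hs0, hTτ] with k hk hsk hTk
    have h2 := integral_one_add_norm_mul_comp_le hπnn hπint hπmom hTk hsk
    refine (integral_mono_of_nonneg (ae_of_all _ (hfarnn k))
      (h2.1.const_mul (Real.exp (-(ε * s k ^ 2)))) (ae_of_all _ hk)).trans ?_
    rw [integral_const_mul]
    calc _ ≤ Real.exp (-(ε * s k ^ 2)) * (s k ^ (d + 1) * C) := by gcongr; exact h2.2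
      _ = _ := by simp only [Function.comp]; ring
  have hnearint : ∀ᶠ k in atTop, Integrable
      fun t => (1 + ‖t‖) * |(S k).indicator (F k) t - g t| := by
    filter_upwards [hnear] with k hk
    refine hDint.mono' (hnmeas k) (ae_of_all _ fun t => ?_)
    rw [Real.norm_of_nonneg (by positivity)]
    exact hk t
  have hsplit : ∀ k t, (1 + ‖t‖) * |F k t - g t| ≤
      (1 + ‖t‖) * |(S k).indicator (F k) t - g t| + (1 + ‖t‖) * (S k)ᶜ.indicator (F k) t := by
    intro k t
    rw [← mul_add]
    gcongr
    have h1 : F k t = (S k).indicator (F k) t + (S k)ᶜ.indicator (F k) t :=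
      (congrFun (Set.indicator_self_add_compl (S k) (F k)) t).symm
    have h2 : 0 ≤ (S k)ᶜ.indicator (F k) t := Set.indicator_nonneg (fun t _ => hFnn k t) _
    calc |F k t - g t| = |((S k).indicator (F k) t - g t) + (S k)ᶜ.indicator (F k) t| := by
          rw [h1]; ring_nf
      _ ≤ _ := (abs_add_le _ _).trans (by rw [abs_of_nonneg h2])
  refine ⟨?_, ?_⟩
  · filter_upwards [hnearint, hfarint] with k h1 h2
    refine (h1.add h2).mono' ?_ (ae_of_all _ fun t => ?_)
    · have := hFmeas k
      have hm : Measurable fun t => (1 + ‖t‖) * |F k t - g t| := by fun_prop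
      exact hm.aestronglyMeasurable
    · rw [Real.norm_of_nonneg (by positivity)]
      exact hsplit k t
  · have h := hnearlim.add hfarlim
    rw [add_zero] at h
    refine squeeze_zero' (Eventually.of_forall fun k => integral_nonneg fun t => by positivity) ?_ h
    filter_upwards [hnearint, hfarint] with k h1 h2
    rw [← integral_add h1 h2]
    exact integral_mono_of_nonneg (ae_of_all _ fun t => by positivity) (h1.add h2)
      (ae_of_all _ (hsplit k))

/-- Normalising a sequence of functions preserves weighted `L¹` convergence. -/
theorem tendsto_integral_one_add_norm_mul_abs_div_sub {d : ℕ} {F : ℕ → (Fin d → ℝ) → ℝ}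
    (hFmeas : ∀ k, Measurable (F k)) {g : (Fin d → ℝ) → ℝ}
    (hgint : Integrable fun t => (1 + ‖t‖) * g t) (hgmeas : Measurable g) (hgnn : ∀ t, 0 ≤ g t)
    (hgpos : 0 < ∫ t, g t) {a : ℝ} (ha : 0 < a)
    (hint : ∀ᶠ k in atTop, Integrable fun t => (1 + ‖t‖) * |F k t - a * g t|)
    (hlim : Tendsto (fun k => ∫ t, (1 + ‖t‖) * |F k t - a * g t|) atTop (nhds 0)) :
    (∀ᶠ k in atTop, Integrable fun t =>
      (1 + ‖t‖) * |F k t / (∫ u, F k u) - (∫ u, g u)⁻¹ * g t|) ∧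
    Tendsto (fun k => ∫ t, (1 + ‖t‖) * |F k t / (∫ u, F k u) - (∫ u, g u)⁻¹ * g t|) atTop
      (nhds 0) := by
  have hg1 : Integrable g := hgint.mono' (by fun_prop) (ae_of_all _ fun t => by
    rw [Real.norm_of_nonneg (hgnn t)]; nlinarith [norm_nonneg t, hgnn t])
  have hdiff : ∀ᶠ k in atTop, Integrable fun t => F k t - a * g t := by
    filter_upwards [hint] with k hk
    have := hFmeas k
    refine hk.mono' (by fun_prop) (ae_of_all _ fun t => ?_)
    rw [Real.norm_eq_abs]
    nlinarith [norm_nonneg t, abs_nonneg (F k t - a * g t)]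
  have hZ : Tendsto (fun k => ∫ u, F k u) atTop (nhds (a * ∫ u, g u)) := by
    rw [tendsto_iff_dist_tendsto_zero]
    refine squeeze_zero' (Eventually.of_forall fun k => dist_nonneg) ?_ hlim
    filter_upwards [hint, hdiff] with k hk hk'
    have hF : Integrable (F k) := (hk'.add (hg1.const_mul a)).congr (ae_of_all _ fun t => by simp)
    rw [Real.dist_eq, ← integral_const_mul, ← integral_sub hF (hg1.const_mul a)]
    refine (abs_integral_le_integral_abs).trans (integral_mono hk'.abs hk fun t => ?_)
    nlinarith [norm_nonneg t, abs_nonneg (F k t - a * g t)]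
  have hZ0 : a * ∫ u, g u ≠ 0 := (mul_pos ha hgpos).ne'
  have hcoef : Tendsto (fun k => |a / (∫ u, F k u) - (∫ u, g u)⁻¹|) atTop (nhds 0) := by
    have := ((tendsto_const_nhds (x := a)).div hZ hZ0).sub_const (∫ u, g u)⁻¹
    have h0 : a / (a * ∫ u, g u) - (∫ u, g u)⁻¹ = 0 := by field_simp; simp
    rw [h0] at this
    simpa using this.abs
  have hbound : ∀ k t, (1 + ‖t‖) * |F k t / (∫ u, F k u) - (∫ u, g u)⁻¹ * g t| ≤
      |(∫ u, F k u)⁻¹| * ((1 + ‖t‖) * |F k t - a * g t|) +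
      |a / (∫ u, F k u) - (∫ u, g u)⁻¹| * ((1 + ‖t‖) * g t) := by
    intro k t
    have h1 : F k t / (∫ u, F k u) - (∫ u, g u)⁻¹ * g t =
        (∫ u, F k u)⁻¹ * (F k t - a * g t) + (a / (∫ u, F k u) - (∫ u, g u)⁻¹) * g t := by
      rw [div_eq_mul_inv, div_eq_mul_inv]; ring
    calc _ ≤ (1 + ‖t‖) * (|(∫ u, F k u)⁻¹ * (F k t - a * g t)| +
          |(a / (∫ u, F k u) - (∫ u, g u)⁻¹) * g t|) := by
          rw [h1]; gcongr; exact abs_add_le _ _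
      _ = _ := by rw [abs_mul, abs_mul, abs_of_nonneg (hgnn t)]; ring
  refine ⟨?_, ?_⟩
  · filter_upwards [hint] with k hk
    have := hFmeas k
    refine ((hk.const_mul |(∫ u, F k u)⁻¹|).add
      (hgint.const_mul |a / (∫ u, F k u) - (∫ u, g u)⁻¹|)).mono'
      (Measurable.aestronglyMeasurable (by fun_prop)) (ae_of_all _ fun t => ?_)
    rw [Real.norm_of_nonneg (by positivity)]
    exact hbound k t
  · have h := ((hZ.inv₀ hZ0).abs.mul hlim).add (hcoef.mul_const (∫ t, (1 + ‖t‖) * g t))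
    rw [mul_zero, zero_mul, add_zero] at h
    refine squeeze_zero' (Eventually.of_forall fun k => integral_nonneg fun t => by positivity) ?_ h
    filter_upwards [hint] with k hk
    rw [← integral_const_mul, ← integral_const_mul,
      ← integral_add (hk.const_mul _) (hgint.const_mul _)]
    exact integral_mono_of_nonneg (ae_of_all _ fun t => by positivity)
      ((hk.const_mul _).add (hgint.const_mul _)) (ae_of_all _ (hbound k))

/-- Completing the square in a second-order expansion with symmetric leading matrix. -/
theorem quadratic_expansion_recentered {d : ℕ} {A R : Matrix (Fin d) (Fin d) ℝ} (hA : A.IsSymm)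
    (hunit : IsUnit A.det) {n : ℝ} (hn : n ≠ 0) (g y : Fin d → ℝ) :
    g ⬝ᵥ (y + n⁻¹ • A⁻¹.mulVec g) - (1 / 2) * ((y + n⁻¹ • A⁻¹.mulVec g) ⬝ᵥ
        (n • A + R).mulVec (y + n⁻¹ • A⁻¹.mulVec g)) -
      (1 / 2) * (n * ((n⁻¹ • A⁻¹.mulVec g) ⬝ᵥ A.mulVec (n⁻¹ • A⁻¹.mulVec g))) =
    -(1 / 2) * (n * (y ⬝ᵥ A.mulVec y)) - (1 / 2) * ((y + n⁻¹ • A⁻¹.mulVec g) ⬝ᵥ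
        R.mulVec (y + n⁻¹ • A⁻¹.mulVec g)) := by
  set τ := n⁻¹ • A⁻¹.mulVec g with hτ
  have hg : g = n • A.mulVec τ := by
    rw [hτ, mulVec_smul, mulVec_mulVec, mul_nonsing_inv _ hunit, one_mulVec, smul_smul,
      mul_inv_cancel₀ hn, one_smul]
  have hsymm : τ ⬝ᵥ A.mulVec y = y ⬝ᵥ A.mulVec τ := by
    rw [dotProduct_mulVec, ← mulVec_transpose, hA.eq, dotProduct_comm]
  have h1 : g ⬝ᵥ (y + τ) = n * (y ⬝ᵥ A.mulVec τ) + n * (τ ⬝ᵥ A.mulVec τ) := by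
    rw [dotProduct_comm, hg, dotProduct_smul, add_dotProduct, smul_eq_mul, mul_add]
  have h2 : (y + τ) ⬝ᵥ (n • A + R).mulVec (y + τ) =
      n * (y ⬝ᵥ A.mulVec y + 2 * (y ⬝ᵥ A.mulVec τ) + τ ⬝ᵥ A.mulVec τ) +
        (y + τ) ⬝ᵥ R.mulVec (y + τ) := by
    rw [add_mulVec, dotProduct_add, smul_mulVec, dotProduct_smul, smul_eq_mul, mulVec_add A,
      add_dotProduct, dotProduct_add, dotProduct_add, hsymm]
    ring
  rw [h1, h2]
  ring

theorem norm_inv_smul_inv_mulVec_le {d : ℕ} {A : Matrix (Fin d) (Fin d) ℝ}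
    (hunit : IsUnit A.det) {c : ℝ} (hc : 0 < c) (hA : ∀ x, c * ‖x‖ ^ 2 ≤ x ⬝ᵥ A.mulVec x)
    {s M : ℝ} (hs : 0 < s) {g : Fin d → ℝ} (hg : ‖g‖ ≤ M * s) :
    s * ‖(s ^ 2)⁻¹ • A⁻¹.mulVec g‖ ≤ d * M / c := by
  set τ := (s ^ 2)⁻¹ • A⁻¹.mulVec g with hτ
  have hAτ : A.mulVec τ = (s ^ 2)⁻¹ • g := by
    rw [hτ, mulVec_smul, mulVec_mulVec, mul_nonsing_inv _ hunit, one_mulVec]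
  have hM : 0 ≤ M := by
    by_contra h
    nlinarith [norm_nonneg g]
  have h1 : c * ‖τ‖ ^ 2 ≤ d * (‖τ‖ * ((s ^ 2)⁻¹ * (M * s))) := by
    calc c * ‖τ‖ ^ 2 ≤ |τ ⬝ᵥ A.mulVec τ| := (hA τ).trans (le_abs_self _)
      _ ≤ d * (‖τ‖ * ‖A.mulVec τ‖) := abs_dotProduct_le_card_mul _ _
      _ ≤ _ := by
        have h : ‖(s ^ 2)⁻¹ • g‖ ≤ (s ^ 2)⁻¹ * (M * s) := by
          rw [norm_smul, Real.norm_of_nonneg (by positivity)]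
          gcongr
        rw [hAτ]
        gcongr
  rcases eq_or_ne ‖τ‖ 0 with h0 | h0
  · rw [h0, mul_zero]; positivity
  have hpos : 0 < ‖τ‖ := lt_of_le_of_ne (norm_nonneg _) (Ne.symm h0)
  rw [le_div_iff₀ hc]
  have h2 : ‖τ‖ * (s * ‖τ‖ * c) ≤ ‖τ‖ * (d * M) := by
    calc ‖τ‖ * (s * ‖τ‖ * c) = s * (c * ‖τ‖ ^ 2) := by ring
      _ ≤ s * (d * (‖τ‖ * ((s ^ 2)⁻¹ * (M * s)))) := by gcongr
      _ = ‖τ‖ * (d * M) := by field_simp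
  exact le_of_mul_le_mul_left h2 hpos

/-- Bernstein–von Mises theorem along a deterministic sequence of log-likelihoods. -/
theorem tendsto_integral_one_add_norm_mul_abs_posterior_sub_gaussian {d : ℕ}
    {Θ : Set (Fin d → ℝ)} (hΘ : MeasurableSet Θ)
    {L : ℕ → (Fin d → ℝ) → ℝ} (hL : ∀ k, ContinuousOn (L k) Θ)
    {θs : ℕ → Fin d → ℝ} {g : ℕ → Fin d → ℝ}
    {V : ℕ → Matrix (Fin d) (Fin d) ℝ} (hVsymm : ∀ k, (V k).IsSymm)
    (hVunit : ∀ k, IsUnit (V k).det) {R : ℕ → (Fin d → ℝ) → Matrix (Fin d) (Fin d) ℝ}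
    {n : ℕ → ℕ} (hn : Tendsto n atTop atTop)
    (hexpand : ∀ k, ∀ θ ∈ Θ,
      L k θ = L k (θs k) + g k ⬝ᵥ (θ - θs k) -
        (1 / 2) * ((θ - θs k) ⬝ᵥ ((n k : ℝ) • V k + R k θ).mulVec (θ - θs k)))
    {π : (Fin d → ℝ) → ℝ} (hπnn : ∀ θ, 0 ≤ π θ) (hπmeas : Measurable π)
    (hπint : Integrable π) (hπmom : Integrable fun θ => ‖θ‖ * π θ)
    {θlim : Fin d → ℝ} (hθlim : θlim ∈ interior Θ) (hθs : Tendsto θs atTop (nhds θlim))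
    {Vlim : Matrix (Fin d) (Fin d) ℝ} (hVlimPD : Vlim.PosDef)
    (hV : Tendsto V atTop (nhds Vlim))
    {M : ℝ} (hg : ∀ k, ‖g k‖ ≤ M * √(n k))
    (hfar : ∀ δ : ℝ, 0 < δ → ∃ ε : ℝ, 0 < ε ∧ ∀ᶠ k in atTop, ∀ θ ∈ Θ, δ ≤ ‖θ - θs k‖ →
      L k θ - L k (θs k) ≤ -(ε * n k))
    (hR : ∀ ε : ℝ, 0 < ε → ∃ δ : ℝ, 0 < δ ∧ ∀ᶠ k in atTop, ∀ θ ∈ Θ, ‖θ - θs k‖ ≤ δ →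
      ‖R k θ‖ < ε * n k)
    (hπcont : ContinuousAt π θlim) (hπpos : 0 < π θlim) :
    Tendsto (fun k => ∫ t in {t : Fin d → ℝ |
        (θs k + (n k : ℝ)⁻¹ • (V k)⁻¹.mulVec (g k)) + (√(n k))⁻¹ • t ∈ Θ},
      (1 + ‖t‖) * |(π ((θs k + (n k : ℝ)⁻¹ • (V k)⁻¹.mulVec (g k)) + (√(n k))⁻¹ • t) *
          Real.exp (L k ((θs k + (n k : ℝ)⁻¹ • (V k)⁻¹.mulVec (g k)) + (√(n k))⁻¹ • t))) /
        (∫ u in {u : Fin d → ℝ |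
            (θs k + (n k : ℝ)⁻¹ • (V k)⁻¹.mulVec (g k)) + (√(n k))⁻¹ • u ∈ Θ},
          π ((θs k + (n k : ℝ)⁻¹ • (V k)⁻¹.mulVec (g k)) + (√(n k))⁻¹ • u) *
            Real.exp (L k ((θs k + (n k : ℝ)⁻¹ • (V k)⁻¹.mulVec (g k)) + (√(n k))⁻¹ • u))) -
        (2 * Real.pi) ^ (-(d : ℝ) / 2) * Vlim.det ^ ((1 : ℝ) / 2) *
          Real.exp (-(1 / 2) * (t ⬝ᵥ Vlim.mulVec t))|) atTop (nhds 0) := by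
  obtain ⟨c, hc, hVlim⟩ := hVlimPD.exists_pos_mul_norm_sq_le
  set s : ℕ → ℝ := fun k => √(n k)
  have hnR : Tendsto (fun k => (n k : ℝ)) atTop atTop := tendsto_natCast_atTop_atTop.comp hn
  have hs : Tendsto s atTop atTop := Real.tendsto_sqrt_atTop.comp hnR
  have hs1 : ∀ᶠ k in atTop, 1 ≤ s k := hs.eventually_ge_atTop 1
  have hsq : ∀ k, (n k : ℝ) = s k ^ 2 := fun k => (Real.sq_sqrt (Nat.cast_nonneg _)).symm
  simp_rw [show ∀ k, √(n k) = s k from fun _ => rfl, hsq] at hexpand hg hfar hR ⊢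
  set τ : ℕ → Fin d → ℝ := fun k => (s k ^ 2)⁻¹ • (V k)⁻¹.mulVec (g k)
  set T : ℕ → Fin d → ℝ := fun k => θs k + τ k
  have hVc : ∀ᶠ k in atTop, ∀ x, c / 2 * ‖x‖ ^ 2 ≤ x ⬝ᵥ (V k).mulVec x := by
    have h0 : Tendsto (fun k => (d : ℝ) ^ 2 * ‖V k - Vlim‖) atTop (nhds 0) := by
      simpa using (tendsto_iff_norm_sub_tendsto_zero.1 hV).const_mul ((d : ℝ) ^ 2)
    filter_upwards [h0.eventually (ge_mem_nhds (half_pos hc))] with k hk x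
    have h1 := abs_quadratic_le (V k - Vlim) x
    rw [sub_mulVec, dotProduct_sub] at h1
    have h2 := (abs_le.1 h1).1
    have h3 : (d : ℝ) ^ 2 * ‖V k - Vlim‖ * ‖x‖ ^ 2 ≤ c / 2 * ‖x‖ ^ 2 := by gcongr
    linarith [hVlim x]
  set H : ℝ := d * M / (c / 2)
  have hτ : ∀ᶠ k in atTop, s k * ‖τ k‖ ≤ H := by
    filter_upwards [hVc, hs1] with k hk hsk
    exact norm_inv_smul_inv_mulVec_le (hVunit k) (half_pos hc) hk (by linarith) (hg k)
  have hsinv : Tendsto (fun k => (s k)⁻¹) atTop (nhds 0) := tendsto_inv_atTop_zero.comp hs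
  have hτ0 : Tendsto τ atTop (nhds 0) := by
    have h := hsinv.mul_const H
    rw [zero_mul] at h
    refine squeeze_zero_norm' ?_ h
    filter_upwards [hτ, hs1] with k hk hsk
    rw [← div_eq_inv_mul, le_div_iff₀ (by linarith)]
    linarith
  have hT : Tendsto T atTop (nhds θlim) := by simpa using hθs.add hτ0
  set m : ℕ → ℝ := fun k => (1 / 2) * (s k ^ 2 * (τ k ⬝ᵥ (V k).mulVec (τ k)))
  have hm : ∀ᶠ k in atTop, 0 ≤ m k := by
    filter_upwards [hVc] with k hk
    have := (by positivity : 0 ≤ c / 2 * ‖τ k‖ ^ 2).trans (hk (τ k))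
    positivity
  set w : ℕ → (Fin d → ℝ) → ℝ := fun k θ => L k θ - L k (θs k) - m k
  have hwcont : ∀ k, ContinuousOn (w k) Θ := fun k =>
    ((hL k).sub continuousOn_const).sub continuousOn_const
  have hw : ∀ᶠ k in atTop, ∀ y, T k + y ∈ Θ → w k (T k + y) =
      -(1 / 2) * (s k ^ 2 * (y ⬝ᵥ (V k).mulVec y)) -
        (1 / 2) * ((y + τ k) ⬝ᵥ (R k (T k + y)).mulVec (y + τ k)) := by
    filter_upwards [hs1] with k hsk y hy
    have hd : T k + y - θs k = y + τ k := by simp only [T]; abel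
    have h := hexpand k _ hy
    rw [hd] at h
    rw [← quadratic_expansion_recentered (hVsymm k) (hVunit k) (by positivity : s k ^ 2 ≠ 0)
      (g k) y]
    simp only [w, h, m, τ]
    ring
  set φ : (Fin d → ℝ) → ℝ := fun t => -(1 / 2) * (t ⬝ᵥ Vlim.mulVec t)
  have hφcont : Continuous φ := by
    have : Continuous fun t : Fin d → ℝ => Vlim.mulVec t := Continuous.matrix_mulVec
      continuous_const continuous_id
    exact continuous_const.mul (continuous_id.dotProduct this)
  have hlim : ∀ t, Tendsto (fun k => w k (T k + (s k)⁻¹ • t)) atTop (nhds (φ t)) := by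
    intro t
    have hpt : Tendsto (fun k => T k + (s k)⁻¹ • t) atTop (nhds θlim) := by
      simpa using hT.add (hsinv.smul_const t)
    have hmem : ∀ᶠ k in atTop, T k + (s k)⁻¹ • t ∈ Θ :=
      hpt.eventually (mem_interior_iff_mem_nhds.1 hθlim)
    have h1 : Tendsto (fun k => -(1 / 2) * (t ⬝ᵥ (V k).mulVec t)) atTop (nhds (φ t)) := by
      have h : Continuous fun A : Matrix (Fin d) (Fin d) ℝ => -(1 / 2) * (t ⬝ᵥ A.mulVec t) :=
        continuous_const.mul (continuous_const.dotProduct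
          (Continuous.matrix_mulVec continuous_id continuous_const))
      exact (h.tendsto Vlim).comp hV
    have h2 : Tendsto (fun k => w k (T k + (s k)⁻¹ • t) - -(1 / 2) * (t ⬝ᵥ (V k).mulVec t)) atTop
        (nhds 0) := by
      rw [Metric.tendsto_nhds]
      intro e he
      set Q : ℝ := (d : ℝ) ^ 2 * (‖t‖ + H) ^ 2 + 1
      have hQ : 0 < Q := by positivity
      obtain ⟨δ, hδ, hRδ⟩ := hR (e / Q) (by positivity)
      have hsmall : ∀ᶠ k in atTop, ‖(s k)⁻¹ • t + τ k‖ ≤ δ := by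
        have : Tendsto (fun k => ‖(s k)⁻¹ • t + τ k‖) atTop (nhds 0) := by
          simpa using ((hsinv.smul_const t).add hτ0).norm
        exact this.eventually (ge_mem_nhds hδ)
      filter_upwards [hRδ, hsmall, hw, hmem, hs1, hτ] with k hk hsm hwk hkΘ hsk hτk
      have hsk0 : 0 < s k := by linarith
      have hd : T k + (s k)⁻¹ • t - θs k = (s k)⁻¹ • t + τ k := by simp only [T]; abel
      have hRk := hk _ hkΘ (by rw [hd]; exact hsm)
      have hnorm : s k * ‖(s k)⁻¹ • t + τ k‖ ≤ ‖t‖ + H := by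
        calc s k * ‖(s k)⁻¹ • t + τ k‖ ≤ s k * (‖(s k)⁻¹ • t‖ + ‖τ k‖) := by
              gcongr; exact norm_add_le _ _
          _ = ‖t‖ + s k * ‖τ k‖ := by
              rw [norm_smul, Real.norm_of_nonneg (by positivity)]; field_simp
          _ ≤ _ := by linarith
      have hmain : s k ^ 2 * (((s k)⁻¹ • t) ⬝ᵥ (V k).mulVec ((s k)⁻¹ • t)) =
          t ⬝ᵥ (V k).mulVec t := by
        rw [mulVec_smul, dotProduct_smul, smul_dotProduct, smul_eq_mul, smul_eq_mul]
        field_simp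
      have hrem := abs_quadratic_le (R k (T k + (s k)⁻¹ • t)) ((s k)⁻¹ • t + τ k)
      rw [hwk _ hkΘ, hmain, dist_zero_right, Real.norm_eq_abs, sub_sub_cancel_left, abs_neg,
        abs_mul, abs_of_pos (by norm_num : (0 : ℝ) < 1 / 2)]
      calc _ ≤ (1 / 2) * ((d : ℝ) ^ 2 * (e / Q * s k ^ 2) * ‖(s k)⁻¹ • t + τ k‖ ^ 2) := by
            refine mul_le_mul_of_nonneg_left (hrem.trans ?_) (by norm_num)
            gcongr
        _ = (1 / 2) * (e / Q) * ((d : ℝ) ^ 2 * (s k * ‖(s k)⁻¹ • t + τ k‖) ^ 2) := by ring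
        _ ≤ (1 / 2) * (e / Q) * Q := by
            gcongr
            have : (s k * ‖(s k)⁻¹ • t + τ k‖) ^ 2 ≤ (‖t‖ + H) ^ 2 := by gcongr
            simp only [Q]
            nlinarith [sq_nonneg (d : ℝ)]
        _ = e / 2 := by field_simp
        _ < e := by linarith
    simpa using h2.add h1
  obtain ⟨r, hr, hrd⟩ : ∃ r : ℝ, 0 < r ∧ (d : ℝ) ^ 2 * r ≤ c / 8 := by
    refine ⟨c / 8 / ((d : ℝ) ^ 2 + 1), by positivity, ?_⟩
    rw [mul_div_assoc', div_le_iff₀ (by positivity)]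
    nlinarith [sq_nonneg (d : ℝ)]
  have hloc : ∃ δ : ℝ, 0 < δ ∧ ∀ᶠ k in atTop, ∀ θ ∈ Θ, ‖θ - T k‖ ≤ δ →
      w k θ ≤ c / 8 * H ^ 2 - c / 8 * (s k * ‖θ - T k‖) ^ 2 := by
    obtain ⟨δ, hδ, hRδ⟩ := hR r hr
    refine ⟨δ / 2, by positivity, ?_⟩
    have hτδ : ∀ᶠ k in atTop, ‖τ k‖ ≤ δ / 2 := by
      have := hτ0.norm
      rw [norm_zero] at this
      exact this.eventually (ge_mem_nhds (half_pos hδ))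
    filter_upwards [hRδ, hτδ, hw, hVc, hτ, hs1] with k hk hτk hwk hVk hτH hsk θ hθ hθδ
    obtain ⟨y, rfl⟩ : ∃ y, θ = T k + y := ⟨θ - T k, by abel⟩
    rw [add_sub_cancel_left] at hθδ ⊢
    have hd : T k + y - θs k = y + τ k := by simp only [T]; abel
    have hyτ := norm_add_le y (τ k)
    have hRk := hk _ hθ (by rw [hd]; linarith)
    have hrem := (abs_le.1 (abs_quadratic_le (R k (T k + y)) (y + τ k))).1
    have hnorm : ‖y + τ k‖ ^ 2 ≤ 2 * ‖y‖ ^ 2 + 2 * ‖τ k‖ ^ 2 := by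
      calc ‖y + τ k‖ ^ 2 ≤ (‖y‖ + ‖τ k‖) ^ 2 := by gcongr
        _ ≤ _ := by nlinarith [sq_nonneg (‖y‖ - ‖τ k‖)]
    have hrem2 : (d : ℝ) ^ 2 * ‖R k (T k + y)‖ * ‖y + τ k‖ ^ 2 ≤
        c / 8 * (2 * (s k * ‖y‖) ^ 2 + 2 * H ^ 2) := by
      calc _ ≤ (d : ℝ) ^ 2 * (r * s k ^ 2) * (2 * ‖y‖ ^ 2 + 2 * ‖τ k‖ ^ 2) := by gcongr
        _ = ((d : ℝ) ^ 2 * r) * (2 * (s k * ‖y‖) ^ 2 + 2 * (s k * ‖τ k‖) ^ 2) := by ring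
        _ ≤ _ := by gcongr
    have hVy : c / 2 * (s k * ‖y‖) ^ 2 ≤ s k ^ 2 * (y ⬝ᵥ (V k).mulVec y) := by
      calc _ = s k ^ 2 * (c / 2 * ‖y‖ ^ 2) := by ring
        _ ≤ _ := by gcongr; exact hVk y
    rw [hwk y hθ]
    linarith
  have hfar' : ∀ δ : ℝ, 0 < δ → ∃ ε : ℝ, 0 < ε ∧ ∀ᶠ k in atTop, ∀ θ ∈ Θ, δ ≤ ‖θ - T k‖ →
      w k θ ≤ -(ε * s k ^ 2) := by
    intro δ hδ
    obtain ⟨ε, hε, h⟩ := hfar (δ / 2) (half_pos hδ)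
    refine ⟨ε, hε, ?_⟩
    have hτδ : ∀ᶠ k in atTop, ‖τ k‖ ≤ δ / 2 := by
      have := hτ0.norm
      rw [norm_zero] at this
      exact this.eventually (ge_mem_nhds (half_pos hδ))
    filter_upwards [h, hτδ, hm] with k hk hτk hmk θ hθ hθδ
    have h1 : ‖θ - T k‖ ≤ ‖θ - θs k‖ + ‖τ k‖ := by
      have : θ - T k = (θ - θs k) - τ k := by simp only [T]; abel
      rw [this]; exact norm_sub_le _ _
    have := hk θ hθ (by linarith)
    simp only [w]
    linarith
  have hφle : ∀ t, φ t ≤ c / 8 * H ^ 2 - c / 8 * ‖t‖ ^ 2 := by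
    intro t
    have h1 := hVlim t
    have h2 : 0 ≤ c / 8 * H ^ 2 := by positivity
    have h3 : 0 ≤ c * ‖t‖ ^ 2 := by positivity
    simp only [φ]
    linarith
  obtain ⟨hint, hconv⟩ := tendsto_integral_one_add_norm_mul_abs_sub hΘ hπnn hπmeas hπint hπmom
    hθlim hπcont hT hs hwcont hφcont hlim (by positivity) hφle hloc hfar'
  have hgint : Integrable fun t => (1 + ‖t‖) * Real.exp (φ t) := by
    refine ((integrable_one_add_norm_mul_exp_neg_mul_pi_norm_sq
      (d := d) (by positivity : 0 < c / 8)).const_mul (Real.exp (c / 8 * H ^ 2))).mono'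
      (by fun_prop) (ae_of_all _ fun t => ?_)
    rw [Real.norm_of_nonneg (by positivity)]
    calc (1 + ‖t‖) * Real.exp (φ t)
        ≤ (1 + ‖t‖) * Real.exp (c / 8 * H ^ 2 - c / 8 * ‖t‖ ^ 2) := by gcongr; exact hφle t
      _ = _ := by rw [sub_eq_add_neg, Real.exp_add, ← neg_mul]; ring
  have hgauss := integral_exp_neg_half_quadratic hVlimPD
  have hgpos : 0 < ∫ t, Real.exp (φ t) := by
    rw [hgauss]
    have := hVlimPD.det_pos
    positivity
  set F : ℕ → (Fin d → ℝ) → ℝ := fun k t =>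
    Θ.indicator (fun θ => π θ * Real.exp (w k θ)) (T k + (s k)⁻¹ • t)
  have hFmeas : ∀ k, Measurable (F k) := fun k =>
    (measurable_indicator_mul_exp hΘ hπmeas (hwcont k)).comp (by fun_prop)
  obtain ⟨hint', hconv'⟩ := tendsto_integral_one_add_norm_mul_abs_div_sub hFmeas hgint
    (by fun_prop) (fun t => (Real.exp_pos _).le) hgpos hπpos hint hconv
  rw [hgauss, inv_inv] at hint' hconv'
  refine squeeze_zero' (Eventually.of_forall fun k => integral_nonneg fun t => by positivity) ?_
    hconv'
  filter_upwards [hint'] with k hk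
  set S : Set (Fin d → ℝ) := {t | T k + (s k)⁻¹ • t ∈ Θ}
  have hS : MeasurableSet S := hΘ.preimage (by fun_prop)
  set b : ℝ := Real.exp (L k (θs k) + m k)
  have hb : b ≠ 0 := (Real.exp_pos _).ne'
  have hFS : ∀ t ∈ S, π (T k + (s k)⁻¹ • t) * Real.exp (L k (T k + (s k)⁻¹ • t)) = b * F k t := by
    intro t ht
    have h1 : F k t = π (T k + (s k)⁻¹ • t) * Real.exp (w k (T k + (s k)⁻¹ • t)) :=
      Set.indicator_of_mem (s := Θ) ht _
    have h2 : L k (T k + (s k)⁻¹ • t) = (L k (θs k) + m k) + w k (T k + (s k)⁻¹ • t) := by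
      simp only [w]; ring
    rw [h1, h2, Real.exp_add]
    ring
  have hF0 : ∀ t, t ∉ S → F k t = 0 := fun t ht => Set.indicator_of_notMem (s := Θ) ht _
  have hZ : ∫ t in S, π (T k + (s k)⁻¹ • t) * Real.exp (L k (T k + (s k)⁻¹ • t)) =
      b * ∫ t, F k t := by
    rw [setIntegral_congr_fun hS hFS, integral_const_mul,
      setIntegral_eq_integral_of_forall_compl_eq_zero hF0]
  rw [hZ]
  refine (le_of_eq (setIntegral_congr_fun hS fun t ht => ?_)).trans
    (setIntegral_le_integral hk (ae_of_all _ fun t => by positivity))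
  change (1 + ‖t‖) * |π (T k + (s k)⁻¹ • t) * Real.exp (L k (T k + (s k)⁻¹ • t)) / _ - _| = _
  rw [hFS t ht, mul_div_mul_left _ _ hb]

/-- If the measures of `B N` do not tend to zero, then one can select points of `B (n k)` along some
`n → ∞` that avoid sets of uniformly small measure and any countable family of sets of vanishing
measure. -/
theorem exists_selection_of_not_tendsto_measure_zero {Ω : Type*} [MeasurableSpace Ω]
    {P : Measure Ω} {B : ℕ → Set Ω} (hB : ¬ Tendsto (fun N => P (B N)) atTop (nhds 0)) :
    ∃ η : ℝ, 0 < η ∧ ∀ C : ℕ → Set Ω, (∀ᶠ N in atTop, P (C N) ≤ ENNReal.ofReal η) →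
      ∀ E : ℕ → ℕ → Set Ω, (∀ j, Tendsto (fun N => P (E j N)) atTop (nhds 0)) →
        ∃ (n : ℕ → ℕ) (ω : ℕ → Ω), Tendsto n atTop atTop ∧
          ∀ k, ω k ∈ B (n k) ∧ ω k ∉ C (n k) ∧ ∀ j ≤ k, ω k ∉ E j (n k) := by
  obtain ⟨e, he, hfreq⟩ : ∃ e > 0, ∃ᶠ N in atTop, e < P (B N) := by
    by_contra! h
    refine hB (ENNReal.tendsto_nhds_zero.2 fun e he => ?_)
    simpa using h e he
  obtain ⟨r, hr0, hre⟩ := ENNReal.lt_iff_exists_nnreal_btwn.1 he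
  have hr : 0 < r := by exact_mod_cast hr0
  refine ⟨(r / 2 : NNReal), by positivity, fun C hC E hE => ?_⟩
  have hex : ∀ k : ℕ, ∃ N ω, k ≤ N ∧ ω ∈ B N ∧ ω ∉ C N ∧ ∀ j ≤ k, ω ∉ E j N := by
    intro k
    have hsum : Tendsto (fun N => ∑ j ∈ Finset.range (k + 1), P (E j N)) atTop (nhds 0) := by
      simpa using tendsto_finsetSum (Finset.range (k + 1)) fun j _ => hE j
    have hpos : (0 : ENNReal) < ((r / 2 : NNReal) : ENNReal) := by
      exact_mod_cast half_pos hr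
    obtain ⟨N, hN, hCN, hEN, hkN⟩ := (hfreq.and_eventually (hC.and
      ((ENNReal.tendsto_nhds_zero.1 hsum _ hpos).and (eventually_ge_atTop k)))).exists
    by_contra! hcon
    have hsub : B N ⊆ C N ∪ ⋃ j ∈ Finset.range (k + 1), E j N := by
      intro ω hω
      by_cases hωC : ω ∈ C N
      · exact Or.inl hωC
      · obtain ⟨j, hj, hjE⟩ := hcon N ω hkN hω hωC
        exact Or.inr (Set.mem_biUnion (Finset.mem_coe.2 (Finset.mem_range_succ_iff.2 hj)) hjE)
    have hle : P (B N) ≤ r := by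
      calc P (B N) ≤ P (C N) + ∑ j ∈ Finset.range (k + 1), P (E j N) :=
            (measure_mono hsub).trans ((measure_union_le _ _).trans
              (add_le_add le_rfl (measure_biUnion_finset_le _ _)))
        _ ≤ ((r / 2 : NNReal) : ENNReal) + ((r / 2 : NNReal) : ENNReal) := by
            rw [ENNReal.ofReal_coe_nnreal] at hCN
            exact add_le_add hCN hEN
        _ = r := by rw [← ENNReal.coe_add, add_halves]
    exact (hN.trans_le hle).not_ge hre.le
  choose n ω hn h using hex
  exact ⟨n, ω, tendsto_atTop_mono hn tendsto_id, h⟩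

/-- The event that a random function, continuous on `S`, stays below a constant on `S` is
measurable. -/
theorem measurableSet_forall_mem_le_of_continuousOn {Ω X : Type*} [MeasurableSpace Ω]
    [TopologicalSpace X] [SecondCountableTopology X] {S : Set X} {f : Ω → X → ℝ}
    (hmeas : ∀ x, Measurable fun ω => f ω x) (hcont : ∀ ω, ContinuousOn (f ω) S) (a : ℝ) :
    MeasurableSet {ω | ∀ x ∈ S, f ω x ≤ a} := by
  obtain ⟨D, hDc, hD⟩ := TopologicalSpace.exists_countable_dense S
  have heq : {ω | ∀ x ∈ S, f ω x ≤ a} = ⋂ x ∈ D, {ω | f ω x ≤ a} := by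
    ext ω
    simp only [Set.mem_ofPred_eq, Set.mem_iInter]
    refine ⟨fun h x _ => h x x.2, fun h x hx => ?_⟩
    have hclosed : IsClosed {y : S | f ω y ≤ a} :=
      isClosed_le (hcont ω).domRestrict continuous_const
    have hsub : closure D ⊆ {y : S | f ω y ≤ a} := hclosed.closure_subset_iff.2 h
    exact hsub (hD ⟨x, hx⟩)
  rw [heq]
  exact MeasurableSet.biInter hDc fun x _ => measurableSet_le (hmeas x) measurable_const

theorem tendsto_measure_compl_zero_of_tendsto_one {Ω : Type*} [MeasurableSpace Ω]
    {P : Measure Ω} [IsProbabilityMeasure P] {A : ℕ → Set Ω} (hA : ∀ N, MeasurableSet (A N))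
    (h : Tendsto (fun N => P (A N)) atTop (nhds 1)) :
    Tendsto (fun N => P (A N)ᶜ) atTop (nhds 0) := by
  simp_rw [fun N => prob_compl_eq_one_sub (hA N) (μ := P)]
  simpa using ENNReal.Tendsto.sub tendsto_const_nhds h (Or.inl ENNReal.one_ne_top)

/-- misspecified Bernstein–von Mises theorem, first-moment-weighted form.
Under Assumptions (A1)–(A6) and additionally (A7): `∫_{ℝ^d} ‖θ‖ π(θ) dθ < ∞`, the random
variables `∫_{√N(Θ−T_N)} (1+‖t‖) |π_N(t|·) − φ_{0,(V*)⁻¹}(t)| dt` converge to `0` in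
`P`-probability as `N → ∞`, where `T_N = θ*_N + N⁻¹ V_N⁻¹ G_N`, `π_N(·|ω)` is the Lebesgue
density of `√N(ϑ − T_N)` for `ϑ` drawn from the posterior with density proportional to
`exp(ℓ_N(ω,·)) π`, and `φ_{0,(V*)⁻¹}(t) = (2π)^{−d/2} det(V*)^{1/2} e^{−½ tᵀ V* t}` is the
normal density with mean `0` and covariance matrix `(V*)⁻¹`. -/
theorem stmt1 {d : ℕ} {Ω : Type*} [MeasurableSpace Ω] (P : Measure Ω) [IsProbabilityMeasure P]
    (Θ : Set (Fin d → ℝ)) (hΘmeas : MeasurableSet Θ)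
    -- misspecified log-likelihoods, measurable in ω, continuous in θ
    (ℓ : ℕ → Ω → (Fin d → ℝ) → ℝ)
    (hℓmeas : ∀ N θ, Measurable fun ω => ℓ N ω θ)
    (hℓcont : ∀ N ω, ContinuousOn (ℓ N ω) Θ)
    -- the points θ*_N, the scores G_N, the matrices V_N and the remainders R_N
    (θs : ℕ → Fin d → ℝ) (hθsΘ : ∀ N, θs N ∈ Θ)
    (G : ℕ → Ω → Fin d → ℝ) (hGmeas : ∀ N, Measurable (G N))
    (V : ℕ → Matrix (Fin d) (Fin d) ℝ)
    (hVsymm : ∀ N, (V N).IsSymm) (hVunit : ∀ N, IsUnit (V N).det)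
    (R : ℕ → Ω → (Fin d → ℝ) → Matrix (Fin d) (Fin d) ℝ)
    (hRsymm : ∀ N ω θ, (R N ω θ).IsSymm)
    (hRmeas : ∀ N θ i j, Measurable fun ω => R N ω θ i j)
    -- the exact second-order expansion of ℓ_N around θ*_N
    (hexpand : ∀ N ω, ∀ θ ∈ Θ,
      ℓ N ω θ = ℓ N ω (θs N) + G N ω ⬝ᵥ (θ - θs N) -
        (1 / 2) * ((θ - θs N) ⬝ᵥ ((N : ℝ) • V N + R N ω θ).mulVec (θ - θs N)))
    -- the prior density π
    (π : (Fin d → ℝ) → ℝ) (hπnn : ∀ θ, 0 ≤ π θ) (hπmeas : Measurable π)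
    (hπdens : ∫ θ, π θ = 1)
    -- (A1)
    (θlim : Fin d → ℝ) (hθlim : θlim ∈ interior Θ)
    (hA1 : Tendsto θs atTop (nhds θlim))
    -- (A2)
    (Vlim : Matrix (Fin d) (Fin d) ℝ) (hVlimSymm : Vlim.IsSymm) (hVlimPD : Vlim.PosDef)
    (hA2 : Tendsto V atTop (nhds Vlim))
    -- (A3): N^{-1/2} G_N is bounded in P-probability
    (hA3 : ∀ η : ℝ, 0 < η → ∃ M : ℝ,
      limsup (fun N : ℕ => (P {ω | M * Real.sqrt N < ‖G N ω‖}).toReal) atTop < η)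
    -- (A4)
    (hA4 : ∀ δ : ℝ, 0 < δ → ∃ ε : ℝ, 0 < ε ∧
      Tendsto (fun N : ℕ => P {ω | ∀ θ ∈ Θ, δ ≤ ‖θ - θs N‖ →
        ℓ N ω θ - ℓ N ω (θs N) ≤ -(ε * N)}) atTop (nhds 1))
    -- (A5)
    (hA5 : ∀ ε : ℝ, 0 < ε → ∃ δ : ℝ, 0 < δ ∧
      Tendsto (fun N : ℕ => P {ω | ∃ θ ∈ Θ, ‖θ - θs N‖ ≤ δ ∧ ε * N ≤ ‖R N ω θ‖})
        atTop (nhds 0))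
    -- (A6)
    (hA6cont : ContinuousAt π θlim) (hA6pos : 0 < π θlim)
    -- the posterior is a.s. well defined: 0 < ∫_Θ exp(ℓ_N(ω,θ)) π(θ) dθ < ∞
    (hposterior : ∀ N : ℕ, ∀ᵐ ω ∂P,
      IntegrableOn (fun θ => Real.exp (ℓ N ω θ) * π θ) Θ volume ∧
      0 < ∫ θ in Θ, Real.exp (ℓ N ω θ) * π θ)
    -- (A7): the prior has a finite first moment
    (hA7 : Integrable (fun θ : Fin d → ℝ => ‖θ‖ * π θ) volume) :
    ∀ ε : ℝ, 0 < ε →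
      Tendsto (fun N : ℕ => P {ω | ε <
        ∫ t in {t : Fin d → ℝ |
            (θs N + (N : ℝ)⁻¹ • (V N)⁻¹.mulVec (G N ω)) + (Real.sqrt N)⁻¹ • t ∈ Θ},
          (1 + ‖t‖) * |(π ((θs N + (N : ℝ)⁻¹ • (V N)⁻¹.mulVec (G N ω)) + (Real.sqrt N)⁻¹ • t) *
              Real.exp (ℓ N ω ((θs N + (N : ℝ)⁻¹ • (V N)⁻¹.mulVec (G N ω)) +
                (Real.sqrt N)⁻¹ • t))) /
            (∫ u in {u : Fin d → ℝ |
                (θs N + (N : ℝ)⁻¹ • (V N)⁻¹.mulVec (G N ω)) + (Real.sqrt N)⁻¹ • u ∈ Θ},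
              π ((θs N + (N : ℝ)⁻¹ • (V N)⁻¹.mulVec (G N ω)) + (Real.sqrt N)⁻¹ • u) *
                Real.exp (ℓ N ω ((θs N + (N : ℝ)⁻¹ • (V N)⁻¹.mulVec (G N ω)) +
                  (Real.sqrt N)⁻¹ • u))) -
            (2 * Real.pi) ^ (-(d : ℝ) / 2) * Vlim.det ^ ((1 : ℝ) / 2) *
              Real.exp (-(1 / 2) * (t ⬝ᵥ Vlim.mulVec t))|})
        atTop (nhds 0) := by
  intro ε hε
  by_contra hnot
  obtain ⟨η, hη, hselect⟩ := exists_selection_of_not_tendsto_measure_zero hnot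
  obtain ⟨M, hM⟩ := hA3 η hη
  have hC : ∀ᶠ N : ℕ in atTop, P {ω | M * Real.sqrt N < ‖G N ω‖} ≤ ENNReal.ofReal η := by
    have hbdd : IsBoundedUnder (· ≤ ·) atTop
        fun N : ℕ => (P {ω | M * Real.sqrt N < ‖G N ω‖}).toReal :=
      isBoundedUnder_of ⟨1, fun N => measureReal_le_one⟩
    filter_upwards [eventually_lt_of_limsup_lt hM hbdd] with N hN
    exact (ENNReal.le_ofReal_iff_toReal_le (measure_ne_top _ _) hη.le).2 hN.le
  have hpos : ∀ j : ℕ, (0 : ℝ) < 1 / ((j : ℝ) + 1) := fun j => Nat.one_div_pos_of_nat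
  choose ε₄ hε₄ hfar using fun j => hA4 _ (hpos j)
  choose δ₅ hδ₅ hrem using fun j => hA5 _ (hpos j)
  have hfar' := fun j => tendsto_measure_compl_zero_of_tendsto_one (fun N => by
    have h := measurableSet_forall_mem_le_of_continuousOn
      (S := Θ ∩ {θ | 1 / ((j : ℝ) + 1) ≤ ‖θ - θs N‖})
      (f := fun ω θ => ℓ N ω θ - ℓ N ω (θs N)) (fun θ => (hℓmeas N θ).sub (hℓmeas N _))
      (fun ω => ((hℓcont N ω).mono Set.inter_subset_left).sub continuousOn_const)
      (-(ε₄ j * N))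
    simpa only [Set.mem_inter_iff, and_imp, Set.mem_ofPred_eq] using h) (hfar j)
  have hE := fun j : ℕ => tendsto_of_tendsto_of_tendsto_of_le_of_le tendsto_const_nhds
    (by simpa only [add_zero] using (hfar' j).add (hrem j)) (fun _ => (zero_le : (0 : ENNReal) ≤ _))
    fun N => measure_union_le (μ := P)
      {ω | ∀ θ ∈ Θ, 1 / ((j : ℝ) + 1) ≤ ‖θ - θs N‖ → ℓ N ω θ - ℓ N ω (θs N) ≤ -(ε₄ j * N)}ᶜ
      {ω | ∃ θ ∈ Θ, ‖θ - θs N‖ ≤ δ₅ j ∧ 1 / ((j : ℝ) + 1) * N ≤ ‖R N ω θ‖}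
  obtain ⟨n, ω, hn, hω⟩ := hselect _ hC _ hE
  have hπint : Integrable π := by
    by_contra h
    rw [integral_undef h] at hπdens
    exact zero_ne_one hπdens
  have hlim := tendsto_integral_one_add_norm_mul_abs_posterior_sub_gaussian hΘmeas
    (L := fun k => ℓ (n k) (ω k)) (fun k => hℓcont _ _) (θs := fun k => θs (n k))
    (g := fun k => G (n k) (ω k)) (V := fun k => V (n k)) (fun k => hVsymm _) (fun k => hVunit _)
    (R := fun k => R (n k) (ω k)) hn (fun k => hexpand _ _) hπnn hπmeas hπint hA7 hθlim
    (hA1.comp hn) hVlimPD (hA2.comp hn) (M := M) (fun k => not_lt.1 (hω k).2.1) ?_ ?_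
    hA6cont hA6pos
  · obtain ⟨k, hk⟩ := (hlim.eventually (gt_mem_nhds hε)).exists
    exact lt_asymm (hω k).1 hk
  · intro δ hδ
    obtain ⟨j, hj⟩ := exists_nat_one_div_lt hδ
    refine ⟨ε₄ j, hε₄ j, ?_⟩
    filter_upwards [eventually_ge_atTop j] with k hk θ hθ hδθ
    have h := (hω k).2.2 j hk
    simp only [Set.mem_union, Set.mem_compl_iff, not_or, not_not] at h
    exact h.1 θ hθ (hj.le.trans hδθ)
  · intro ε' hε'
    obtain ⟨j, hj⟩ := exists_nat_one_div_lt hε'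
    refine ⟨δ₅ j, hδ₅ j, ?_⟩
    filter_upwards [eventually_ge_atTop j] with k hk θ hθ hδθ
    have h := (hω k).2.2 j hk
    simp only [Set.mem_union, not_or] at h
    have h2 : ‖R (n k) (ω k) θ‖ < 1 / ((j : ℝ) + 1) * n k := by
      by_contra hcon
      exact h.2 ⟨θ, hθ, hδθ, not_lt.1 hcon⟩
    exact h2.trans_le (by gcongr)
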